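/- Let α > 0 be a real number with α ∉ √2·ℚ, with H₄-expansion data G_n = (t_n, v_n; u_n, w_n), α_n = (w_n·α − v_n)/(t_n − u_n·α), α*_n = w_n/u_n. For every n ≥ m(α)+1, the fraction v_n/w_n is an H₄-best approximation of α if and only if α_n < 1 or α*_n < 1. -/

import Mathlib

/-- A matrix (p, r; q, s) has the first H4 form (without sign). -/
def H4form (p r q s : ℝ) : Prop :=
  (∃ a b c d : ℤ, Odd a ∧ Odd d ∧ a * d - 2 * b * c = 1 ∧
     p = (a : ℝ) ∧ r = Real.sqrt 2 * b ∧ q = Real.sqrt 2 * c ∧ s = (d : ℝ)) ∨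
  (∃ a b c d : ℤ, Odd b ∧ Odd c ∧ 2 * a * d - b * c = 1 ∧
     p = Real.sqrt 2 * a ∧ r = (b : ℝ) ∧ q = (c : ℝ) ∧ s = Real.sqrt 2 * d)

/-- The matrix (p, r; q, s) belongs to the Hecke group H4 (up to sign). -/
def H4 (p r q s : ℝ) : Prop := H4form p r q s ∨ H4form (-p) (-r) (-q) (-s)

/-- p/q ∈ ℚ(H₄): q > 0 and (p, r; q, s) ∈ H₄ for some reals r, s. -/
def QH4 (p q : ℝ) : Prop := 0 < q ∧ ∃ r s : ℝ, H4 p r q s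

/-- α ∉ √2·ℚ. -/
def NotSqrt2Rat (α : ℝ) : Prop := ¬ ∃ x : ℚ, α = Real.sqrt 2 * (x : ℝ)

/-- p/q ∈ ℚ(H₄) is an H₄-best approximation of α. -/
def IsBest (α p q : ℝ) : Prop :=
  QH4 p q ∧ ∀ r s : ℝ, QH4 r s → r / s ≠ p / q → s ≤ q → |q * α - p| < |s * α - r|

/-- The matrices A₁, A₂, A₃ generating the H₄-expansion. -/
noncomputable def Amat : ℕ → Matrix (Fin 2) (Fin 2) ℝ
  | 1 => !![1, 0; Real.sqrt 2, 1]
  | 2 => !![Real.sqrt 2, 1; 1, Real.sqrt 2]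
  | _ => !![1, Real.sqrt 2; 0, 1]

/-- G_n = A_{d₁} ⋯ A_{d_n}. -/
noncomputable def Gmat (d : ℕ → ℕ) (n : ℕ) : Matrix (Fin 2) (Fin 2) ℝ :=
  ((List.range n).map (fun i => Amat (d (i + 1)))).prod

noncomputable def tn (d : ℕ → ℕ) (n : ℕ) : ℝ := Gmat d n 0 0
noncomputable def vn (d : ℕ → ℕ) (n : ℕ) : ℝ := Gmat d n 0 1
noncomputable def un (d : ℕ → ℕ) (n : ℕ) : ℝ := Gmat d n 1 0
noncomputable def wn (d : ℕ → ℕ) (n : ℕ) : ℝ := Gmat d n 1 1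

/-- α_n = G_n⁻¹ · α. -/
noncomputable def alphan (d : ℕ → ℕ) (α : ℝ) (n : ℕ) : ℝ :=
  (wn d n * α - vn d n) / (tn d n - un d n * α)

/-- α*_n = w_n / u_n. -/
noncomputable def alphast (d : ℕ → ℕ) (n : ℕ) : ℝ := wn d n / un d n

/-- Multiplying by a generator on the right preserves the unsigned first and second forms. -/
lemma H4form.mul_generator {t v u w : ℝ} (h : H4form t v u w) :
    H4form (t + √2 * v) v (u + √2 * w) w ∧
    H4form (√2 * t + v) (t + √2 * v) (√2 * u + w) (u + √2 * w) ∧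
    H4form t (√2 * t + v) u (√2 * u + w) := by
  have h2 : √2 * √2 = 2 := Real.mul_self_sqrt (by norm_num)
  rcases h with ⟨a, b, c, d, ha, hd, hdet, rfl, rfl, rfl, rfl⟩ |
    ⟨a, b, c, d, hb, hc, hdet, rfl, rfl, rfl, rfl⟩
  · refine ⟨Or.inl ⟨a + 2 * b, b, c + d, d, ?_, hd, ?_, ?_, ?_, ?_, ?_⟩,
      Or.inr ⟨a + b, a + 2 * b, 2 * c + d, c + d, ?_, ?_, ?_, ?_, ?_, ?_, ?_⟩,
      Or.inl ⟨a, a + b, c, 2 * c + d, ha, ?_, ?_, ?_, ?_, ?_, ?_⟩⟩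
    all_goals first
      | (apply Odd.add_even ha; simp)
      | (apply Even.add_odd _ hd; simp)
      | linear_combination hdet
      | (push_cast; ring1)
      | (push_cast; linear_combination (b : ℝ) * h2)
      | (push_cast; linear_combination (c : ℝ) * h2)
  · refine ⟨Or.inr ⟨a + b, b, c + 2 * d, d, hb, ?_, ?_, ?_, ?_, ?_, ?_⟩,
      Or.inl ⟨2 * a + b, a + b, c + d, c + 2 * d, ?_, ?_, ?_, ?_, ?_, ?_, ?_⟩,
      Or.inr ⟨a, 2 * a + b, c, c + d, ?_, hc, ?_, ?_, ?_, ?_, ?_⟩⟩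
    all_goals first
      | (apply Odd.add_even hc; simp)
      | (apply Even.add_odd _ hb; simp)
      | linear_combination hdet
      | (push_cast; ring1)
      | (push_cast; linear_combination (a : ℝ) * h2)
      | (push_cast; linear_combination (d : ℝ) * h2)

lemma H4form.det {t v u w : ℝ} (h : H4form t v u w) : t * w - v * u = 1 := by
  have h2 : √2 * √2 = 2 := Real.mul_self_sqrt (by norm_num)
  rcases h with ⟨a, b, c, d, -, -, hdet, rfl, rfl, rfl, rfl⟩ |
    ⟨a, b, c, d, -, -, hdet, rfl, rfl, rfl, rfl⟩
  · have : (a * d - 2 * b * c : ℝ) = 1 := mod_cast hdet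
    linear_combination this - (b * c : ℝ) * h2
  · have : (2 * a * d - b * c : ℝ) = 1 := mod_cast hdet
    linear_combination this + (a * d : ℝ) * h2

/-- Interchanging the two columns and changing one sign preserves the forms. -/
lemma H4form.rotate {t v u w : ℝ} (h : H4form t v u w) : H4form v (-t) w (-u) := by
  rcases h with ⟨a, b, c, d, ha, hd, hdet, rfl, rfl, rfl, rfl⟩ |
    ⟨a, b, c, d, hb, hc, hdet, rfl, rfl, rfl, rfl⟩
  · exact Or.inr ⟨b, -a, d, -c, ha.neg, hd, by linear_combination hdet, rfl,
      by push_cast; ring, rfl, by push_cast; ring⟩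
  · exact Or.inl ⟨b, -a, d, -c, hb, hc.neg, by linear_combination hdet, rfl,
      by push_cast; ring, rfl, by push_cast; ring⟩

/-- The vectors with one coordinate in `ℤ` and the other in `√2 ℤ`. -/
def MixedIntegral (x y : ℝ) : Prop :=
  (∃ a c : ℤ, x = a ∧ y = √2 * c) ∨ (∃ a c : ℤ, x = √2 * a ∧ y = c)

lemma H4form.mixedIntegral {t v u w : ℝ} (h : H4form t v u w) : MixedIntegral t u := by
  rcases h with ⟨a, b, c, d, -, -, -, rfl, rfl, rfl, rfl⟩ |
    ⟨a, b, c, d, -, -, -, rfl, rfl, rfl, rfl⟩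
  · exact Or.inl ⟨a, c, rfl, rfl⟩
  · exact Or.inr ⟨a, c, rfl, rfl⟩

lemma MixedIntegral.neg {x y : ℝ} (h : MixedIntegral x y) : MixedIntegral (-x) (-y) := by
  rcases h with ⟨a, c, rfl, rfl⟩ | ⟨a, c, rfl, rfl⟩
  · exact Or.inl ⟨-a, -c, by push_cast; ring, by push_cast; ring⟩
  · exact Or.inr ⟨-a, -c, by push_cast; ring, by push_cast; ring⟩

lemma QH4.mixedIntegral {p q : ℝ} (h : QH4 p q) : MixedIntegral p q := by
  obtain ⟨-, r, s, h | h⟩ := h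
  · exact h.mixedIntegral
  · simpa using h.mixedIntegral.neg

/-- Mixed integral vectors are preserved by the inverse of a matrix of `H4form`. -/
lemma MixedIntegral.inv_apply {t v u w r s : ℝ} (h : H4form t v u w) (hrs : MixedIntegral r s) :
    MixedIntegral (w * r - v * s) (t * s - u * r) := by
  have h2 : √2 * √2 = 2 := Real.mul_self_sqrt (by norm_num)
  rcases h with ⟨a, b, c, d, -, -, -, rfl, rfl, rfl, rfl⟩ |
      ⟨a, b, c, d, -, -, -, rfl, rfl, rfl, rfl⟩ <;>
    rcases hrs with ⟨k, l, rfl, rfl⟩ | ⟨k, l, rfl, rfl⟩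
  · exact Or.inl ⟨d * k - 2 * b * l, a * l - c * k,
      by push_cast; linear_combination (-b * l : ℝ) * h2, by push_cast; ring⟩
  · exact Or.inr ⟨d * k - b * l, a * l - 2 * c * k,
      by push_cast; ring, by push_cast; linear_combination (-c * k : ℝ) * h2⟩
  · exact Or.inr ⟨d * k - b * l, 2 * a * l - c * k,
      by push_cast; ring, by push_cast; linear_combination (a * l : ℝ) * h2⟩
  · exact Or.inl ⟨2 * d * k - b * l, a * l - c * k,
      by push_cast; linear_combination (d * k : ℝ) * h2, by push_cast; ring⟩

lemma one_le_abs_intCast {k : ℤ} (hk : (k : ℝ) ≠ 0) : 1 ≤ |(k : ℝ)| := by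
  exact_mod_cast Int.one_le_abs (by exact_mod_cast hk)

lemma one_le_abs_sqrt_two_mul_intCast {k : ℤ} (hk : √2 * k ≠ 0) : 1 ≤ |√2 * k| := by
  rw [abs_mul, abs_of_nonneg (Real.sqrt_nonneg 2)]
  exact one_le_mul_of_one_le_of_one_le (Real.one_le_sqrt.2 (by norm_num))
    (one_le_abs_intCast (right_ne_zero_of_mul hk))

lemma MixedIntegral.one_le_abs_left {x y : ℝ} (h : MixedIntegral x y) (hx : x ≠ 0) :
    1 ≤ |x| := by
  rcases h with ⟨a, c, rfl, rfl⟩ | ⟨a, c, rfl, rfl⟩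
  · exact one_le_abs_intCast hx
  · exact one_le_abs_sqrt_two_mul_intCast hx

lemma MixedIntegral.one_le_abs_right {x y : ℝ} (h : MixedIntegral x y) (hy : y ≠ 0) :
    1 ≤ |y| := by
  rcases h with ⟨a, c, rfl, rfl⟩ | ⟨a, c, rfl, rfl⟩
  · exact one_le_abs_sqrt_two_mul_intCast hy
  · exact one_le_abs_intCast hy

lemma Gmat_succ (d : ℕ → ℕ) (n : ℕ) : Gmat d (n + 1) = Gmat d n * Amat (d (n + 1)) := by
  simp [Gmat, List.range_succ]

/-- The matrices `Gmat d n` lie in the positive part of `H4`; the lower left entry becomes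
positive once a digit other than `3` has occurred. -/
lemma Gmat_properties (d : ℕ → ℕ) (hd : ∀ n : ℕ, 1 ≤ n → d n = 1 ∨ d n = 2 ∨ d n = 3)
    (m : ℕ) (hm : d (m + 1) ≠ 3) (n : ℕ) :
    H4form (tn d n) (vn d n) (un d n) (wn d n) ∧ 0 ≤ un d n ∧ 0 < wn d n ∧
      (m + 1 ≤ n → 0 < un d n) := by
  have hs : 0 < √2 := Real.sqrt_pos.2 (by norm_num)
  induction n with
  | zero =>
    simp only [tn, vn, un, wn, Gmat]
    refine ⟨Or.inl ⟨1, 0, 0, 1, ?_⟩, ?_⟩ <;> simp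
  | succ n ih =>
    obtain ⟨hf, hu, hw, hpos⟩ := ih
    obtain ⟨h₁, h₂, h₃⟩ := hf.mul_generator
    have hsu := mul_nonneg hs.le hu
    have hsw := mul_pos hs hw
    rcases hd (n + 1) (by omega) with h | h | h
    · have et : tn d (n + 1) = tn d n + √2 * vn d n := by
        simp [tn, vn, Gmat_succ, h, Amat, Matrix.mul_apply, Fin.sum_univ_two, mul_comm]
      have ev : vn d (n + 1) = vn d n := by
        simp [vn, Gmat_succ, h, Amat, Matrix.mul_apply, Fin.sum_univ_two]
      have eu : un d (n + 1) = un d n + √2 * wn d n := by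
        simp [un, wn, Gmat_succ, h, Amat, Matrix.mul_apply, Fin.sum_univ_two, mul_comm]
      have ew : wn d (n + 1) = wn d n := by
        simp [wn, Gmat_succ, h, Amat, Matrix.mul_apply, Fin.sum_univ_two]
      rw [et, ev, eu, ew]
      exact ⟨h₁, by positivity, hw, fun _ => by positivity⟩
    · have et : tn d (n + 1) = √2 * tn d n + vn d n := by
        simp [tn, vn, Gmat_succ, h, Amat, Matrix.mul_apply, Fin.sum_univ_two, mul_comm]
      have ev : vn d (n + 1) = tn d n + √2 * vn d n := by
        simp [tn, vn, Gmat_succ, h, Amat, Matrix.mul_apply, Fin.sum_univ_two, mul_comm]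
      have eu : un d (n + 1) = √2 * un d n + wn d n := by
        simp [un, wn, Gmat_succ, h, Amat, Matrix.mul_apply, Fin.sum_univ_two, mul_comm]
      have ew : wn d (n + 1) = un d n + √2 * wn d n := by
        simp [un, wn, Gmat_succ, h, Amat, Matrix.mul_apply, Fin.sum_univ_two, mul_comm]
      rw [et, ev, eu, ew]
      exact ⟨h₂, by positivity, by positivity, fun _ => by positivity⟩
    · have et : tn d (n + 1) = tn d n := by
        simp [tn, Gmat_succ, h, Amat, Matrix.mul_apply, Fin.sum_univ_two]
      have ev : vn d (n + 1) = √2 * tn d n + vn d n := by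
        simp [tn, vn, Gmat_succ, h, Amat, Matrix.mul_apply, Fin.sum_univ_two, mul_comm]
      have eu : un d (n + 1) = un d n := by
        simp [un, Gmat_succ, h, Amat, Matrix.mul_apply, Fin.sum_univ_two]
      have ew : wn d (n + 1) = √2 * un d n + wn d n := by
        simp [un, wn, Gmat_succ, h, Amat, Matrix.mul_apply, Fin.sum_univ_two, mul_comm]
      rw [et, ev, eu, ew]
      refine ⟨h₃, hu, by positivity, fun hn => hpos ?_⟩
      by_contra hlt
      have hnm : n = m := by omega
      exact hm (hnm ▸ h)

theorem vn_wn_best_iff (α : ℝ) (hα : 0 < α) (hirr : NotSqrt2Rat α)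
    (d : ℕ → ℕ)
    (hd : ∀ n : ℕ, 1 ≤ n → d n = 1 ∨ d n = 2 ∨ d n = 3)
    (hmem : ∀ n : ℕ, 1 ≤ n → vn d n < wn d n * α ∧ un d n * α < tn d n)
    (m : ℕ) (hm : ∀ n : ℕ, 1 ≤ n → n ≤ m → d n = 3) (hm1 : d (m + 1) ≠ 3)
    (n : ℕ) (hn : m + 1 ≤ n) :
    IsBest α (vn d n) (wn d n) ↔ (alphan d α n < 1 ∨ alphast d n < 1) := by
  obtain ⟨hf, -, hw, hpos⟩ := Gmat_properties d hd m hm1 n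
  obtain ⟨hP, hQ⟩ := hmem n (by omega)
  have hu := hpos hn
  have hdet := hf.det
  unfold alphan alphast
  generalize tn d n = t at *
  generalize vn d n = v at *
  generalize un d n = u at *
  generalize wn d n = w at *
  rw [div_lt_one (sub_pos.2 hQ), div_lt_one hu]
  constructor
  · rintro ⟨-, hbest⟩
    by_contra! hcon
    have hne : t / u ≠ v / w := by
      rw [Ne, div_eq_div_iff hu.ne' hw.ne']
      intro h
      linarith
    have := hbest t u ⟨hu, v, w, Or.inl hf⟩ hne hcon.2
    rw [abs_of_pos (sub_pos.2 hP), abs_of_neg (sub_neg.2 hQ)] at this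
    linarith [hcon.1]
  · intro hor
    refine ⟨⟨hw, -t, -u, Or.inl hf.rotate⟩, fun r s hrs hne hsw => ?_⟩
    have hXY := MixedIntegral.inv_apply hf hrs.mixedIntegral
    have hs := hrs.1
    obtain ⟨X, hX⟩ : ∃ X, X = w * r - v * s := ⟨_, rfl⟩
    obtain ⟨Y, hY⟩ : ∃ Y, Y = t * s - u * r := ⟨_, rfl⟩
    rw [← hX, ← hY] at hXY
    have er : r = t * X + v * Y := by rw [hX, hY]; linear_combination (-r) * hdet
    have es : s = u * X + w * Y := by rw [hX, hY]; linear_combination (-s) * hdet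
    have hX0 : X ≠ 0 := by
      rintro rfl
      apply hne
      rw [div_eq_div_iff hs.ne' hw.ne']
      linear_combination -hX
    have hX1 := hXY.one_le_abs_left hX0
    have key : s * α - r = (w * α - v) * Y - (t - u * α) * X := by rw [er, es]; ring
    rw [key, abs_of_pos (sub_pos.2 hP)]
    have hP' := sub_pos.2 hP
    have hQ' := sub_pos.2 hQ
    generalize w * α - v = P at *
    generalize t - u * α = Q at *
    rcases eq_or_ne Y 0 with rfl | hY0
    · have hXpos : 0 < X := by
        by_contra! h
        nlinarith [mul_nonneg hu.le (neg_nonneg.2 h)]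
      rw [abs_of_pos hXpos] at hX1
      have hwu : u ≤ w := by nlinarith
      have hPQ : P < Q := hor.resolve_right (not_lt.2 hwu)
      rw [mul_zero, zero_sub, abs_neg, abs_of_pos (mul_pos hQ' hXpos)]
      nlinarith
    have hY1 := hXY.one_le_abs_right hY0
    rcases lt_or_gt_of_ne hX0 with hXn | hXp <;> rcases lt_or_gt_of_ne hY0 with hYn | hYp
    · nlinarith [mul_pos_of_neg_of_neg (neg_neg_of_pos hu) hXn,
        mul_pos_of_neg_of_neg (neg_neg_of_pos hw) hYn]
    · rw [abs_of_pos hYp] at hY1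
      have := mul_pos hQ' (neg_pos.2 hXn)
      rw [lt_abs]; left; nlinarith
    · rw [abs_of_neg hYn] at hY1
      have := mul_pos hQ' hXp
      rw [lt_abs]; right; nlinarith
    · rw [abs_of_pos hYp] at hY1
      nlinarith [mul_pos hu hXp]
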